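/- Let a, b, c, d > 0 with a+b > c > max{a, b}, and define on [0, ∞): f(x) = F(a,b;c;1−(1+x)^{−1/d}) and g(x) = (1+x)^{((c+d)−(a+b))/d} f'(x). Then g is increasing on [0,∞), with g(0) = ab/(cd) and g(x) → (a+b−c)Γ(c)Γ(a+b−c)/(d·Γ(a)Γ(b)) as x → ∞. -/

import Mathlib

open Filter Set

/-- Shifted factorial (Appell symbol) `(a,n) = a(a+1)⋯(a+n−1)`, with `(a,0)=1`. -/
noncomputable def shiftedFact (a : ℝ) (n : ℕ) : ℝ := ∏ i ∈ Finset.range n, (a + i)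

/-- Gaussian hypergeometric function `F(a,b;c;x)` as a real power series. -/
noncomputable def hypF (a b c x : ℝ) : ℝ :=
  ∑' n : ℕ, (shiftedFact a n * shiftedFact b n / (shiftedFact c n * (n.factorial : ℝ))) * x ^ n

/-- Beta function `B(x,y) = Γ(x)Γ(y)/Γ(x+y)`. -/
noncomputable def betaR (x y : ℝ) : ℝ := Real.Gamma x * Real.Gamma y / Real.Gamma (x + y)

lemma shiftedFact_succ (a : ℝ) (n : ℕ) :
    shiftedFact a (n + 1) = shiftedFact a n * (a + n) := by
  simp [shiftedFact, Finset.prod_range_succ]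

lemma shiftedFact_succ' (a : ℝ) (n : ℕ) :
    shiftedFact a (n + 1) = a * shiftedFact (a + 1) n := by
  simp only [shiftedFact, Finset.prod_range_succ', Nat.cast_zero, add_zero, mul_comm a]
  congr 1
  refine Finset.prod_congr rfl fun i _ => ?_
  push_cast
  ring

lemma shiftedFact_pos {a : ℝ} (ha : 0 < a) (n : ℕ) : 0 < shiftedFact a n :=
  Finset.prod_pos fun i _ => by positivity

lemma shiftedFact_eq_ascPochhammer (a : ℝ) (n : ℕ) :
    shiftedFact a n = (ascPochhammer ℝ n).eval a := by
  induction n with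
  | zero => simp [shiftedFact]
  | succ n ih => rw [shiftedFact_succ, ih, ascPochhammer_succ_eval]

/-- The `n`-th Taylor coefficient of `F(a,b;c;x)` at `x = 0`. -/
noncomputable def hypCoeff (a b c : ℝ) (n : ℕ) : ℝ :=
  shiftedFact a n * shiftedFact b n / (shiftedFact c n * (n.factorial : ℝ))

lemma hypCoeff_pos {a b c : ℝ} (ha : 0 < a) (hb : 0 < b) (hc : 0 < c) (n : ℕ) :
    0 < hypCoeff a b c n := by
  have := shiftedFact_pos ha n
  have := shiftedFact_pos hb n
  have := shiftedFact_pos hc n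
  unfold hypCoeff
  positivity

lemma succ_mul_hypCoeff_succ (a b : ℝ) {c : ℝ} (hc : 0 < c) (n : ℕ) :
    ((n + 1 : ℕ) : ℝ) * hypCoeff a b c (n + 1) = a * b / c * hypCoeff (a + 1) (b + 1) (c + 1) n := by
  have := shiftedFact_pos (show 0 < c + 1 by linarith) n
  simp only [hypCoeff, shiftedFact_succ', Nat.factorial_succ]
  push_cast
  field_simp

lemma hypCoeff_summable {a b c : ℝ} (ha : 0 < a) (hb : 0 < b) (hc : 0 < c) {t : ℝ}
    (ht : |t| < 1) : Summable fun n => hypCoeff a b c n * t ^ n := by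
  have hr : (ordinaryHypergeometricSeries ℝ a b c).radius = 1 :=
    ordinaryHypergeometricSeries_radius_eq_one ℝ a b c fun k => by
      have : (0 : ℝ) ≤ k := k.cast_nonneg
      refine ⟨?_, ?_, ?_⟩ <;> intro h <;> linarith
  have hs := (ordinaryHypergeometricSeries ℝ a b c).summable (x := t) (by
    rw [hr]
    simpa [enorm_eq_nnnorm, ← NNReal.coe_lt_coe] using ht)
  refine hs.congr fun n => ?_
  rw [ordinaryHypergeometricSeries_apply_eq, hypCoeff, shiftedFact_eq_ascPochhammer,
    shiftedFact_eq_ascPochhammer, shiftedFact_eq_ascPochhammer, smul_eq_mul]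
  field_simp

lemma hypF_hasDerivAt {a b c : ℝ} (ha : 0 < a) (hb : 0 < b) (hc : 0 < c) {t : ℝ}
    (ht : |t| < 1) :
    HasDerivAt (hypF a b c) (a * b / c * hypF (a + 1) (b + 1) (c + 1) t) t := by
  obtain ⟨ρ, htρ, hρ⟩ := exists_between ht
  have hρ0 : 0 < ρ := (abs_nonneg t).trans_lt htρ
  have key : ∀ x : ℝ, |x| < 1 →
      Summable fun n : ℕ => hypCoeff a b c n * (n * x ^ (n - 1)) := by
    intro x hx
    rw [← summable_nat_add_iff 1]
    refine ((hypCoeff_summable (a := a + 1) (b := b + 1) (c := c + 1) (by linarith)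
      (by linarith) (by linarith) hx).mul_left (a * b / c)).congr fun n => ?_
    rw [← mul_assoc, ← succ_mul_hypCoeff_succ a b hc, Nat.add_sub_cancel]
    ring
  have hd := hasDerivAt_tsum_of_isPreconnected (𝕜 := ℝ) (g := fun n x => hypCoeff a b c n * x ^ n)
    (g' := fun n x => hypCoeff a b c n * (n * x ^ (n - 1)))
    (key ρ (by rwa [abs_of_pos hρ0])) (Metric.isOpen_ball (x := (0 : ℝ)) (ε := ρ))
    (convex_ball _ _).isPreconnected
    (fun n y _ => (hasDerivAt_pow n y).const_mul _)
    (fun n y hy => by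
      have hy' : |y| ≤ ρ := by simpa using (Metric.mem_ball.1 hy).le
      rw [norm_mul, norm_mul, norm_pow, Real.norm_of_nonneg (hypCoeff_pos ha hb hc n).le,
        Real.norm_of_nonneg n.cast_nonneg, Real.norm_eq_abs]
      have := (hypCoeff_pos ha hb hc n).le
      gcongr)
    (by simpa using htρ : t ∈ Metric.ball (0 : ℝ) ρ) (hypCoeff_summable ha hb hc ht)
    (by simpa using htρ : t ∈ Metric.ball (0 : ℝ) ρ)
  refine hd.congr_deriv ?_
  rw [(key t ht).tsum_eq_zero_add, hypF, ← tsum_mul_left]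
  simp only [Nat.cast_zero, zero_mul, mul_zero, zero_add, Nat.add_sub_cancel]
  refine tsum_congr fun n => ?_
  rw [← mul_assoc, ← mul_assoc, mul_comm (hypCoeff a b c (n + 1)), succ_mul_hypCoeff_succ a b hc, hypCoeff]

lemma hasSum_one_div_one_sub_rpow (s : ℝ) {t : ℝ} (ht : |t| < 1) :
    HasSum (fun n : ℕ => shiftedFact s n / n.factorial * t ^ n) (1 / (1 - t) ^ s) := by
  have h := (Real.one_div_one_sub_rpow_hasFPowerSeriesOnBall_zero s).hasSum (y := t)
    (by simpa [enorm_eq_nnnorm, ← NNReal.coe_lt_coe] using ht)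
  simp only [zero_add] at h
  convert! h using 2 with n
  have hm := Ring.factorial_nsmul_multichoose_eq_ascPochhammer s n
  rw [Polynomial.ascPochhammer_smeval_eq_eval, ← shiftedFact_eq_ascPochhammer, nsmul_eq_mul,
    Ring.multichoose_eq] at hm
  rw [FormalMultilinearSeries.ofScalars_apply_eq, smul_eq_mul, ← hm,
    mul_div_cancel_left₀ _ (by positivity)]

/-- Biernacki–Krzyż: the quotient of two power series is monotone if the quotient of their
coefficients is. -/
lemma tsum_mul_tsum_le_of_coeff {A B : ℕ → ℝ} {x y : ℝ}
    (hAB : ∀ m n, n ≤ m → A n * B m ≤ A m * B n) (hx : 0 ≤ x) (hxy : x ≤ y)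
    (hA : ∀ n, 0 ≤ A n) (hB : ∀ n, 0 ≤ B n)
    (hAx : Summable fun n => A n * x ^ n) (hAy : Summable fun n => A n * y ^ n)
    (hBx : Summable fun n => B n * x ^ n) (hBy : Summable fun n => B n * y ^ n) :
    (∑' n, A n * x ^ n) * ∑' n, B n * y ^ n ≤ (∑' n, A n * y ^ n) * ∑' n, B n * x ^ n := by
  have hy : 0 ≤ y := hx.trans hxy
  have h₁ := hAx.mul_of_nonneg hBy (fun n => mul_nonneg (hA n) (pow_nonneg hx n))
    (fun n => mul_nonneg (hB n) (pow_nonneg hy n))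
  have h₂ := hAy.mul_of_nonneg hBx (fun n => mul_nonneg (hA n) (pow_nonneg hy n))
    (fun n => mul_nonneg (hB n) (pow_nonneg hx n))
  rw [hAx.tsum_mul_tsum hBy h₁, hAy.tsum_mul_tsum hBx h₂]
  have h₁' := (Equiv.prodComm ℕ ℕ).summable_iff.2 h₁
  have h₂' := (Equiv.prodComm ℕ ℕ).summable_iff.2 h₂
  have e₁ := (Equiv.prodComm ℕ ℕ).tsum_eq fun p : ℕ × ℕ => A p.1 * x ^ p.1 * (B p.2 * y ^ p.2)
  have e₂ := (Equiv.prodComm ℕ ℕ).tsum_eq fun p : ℕ × ℕ => A p.1 * y ^ p.1 * (B p.2 * x ^ p.2)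
  have hpow : ∀ m n, n ≤ m → x ^ m * y ^ n ≤ y ^ m * x ^ n := by
    intro m n h
    obtain ⟨k, rfl⟩ := Nat.exists_eq_add_of_le h
    rw [pow_add, pow_add]
    have := pow_le_pow_left₀ hx hxy k
    have : 0 ≤ x ^ n * y ^ n := by positivity
    nlinarith
  have hle := (h₁.add h₁').tsum_le_tsum (f := fun p : ℕ × ℕ => _) (fun p => ?_) (h₂.add h₂')
  · rw [h₁.tsum_add h₁', h₂.tsum_add h₂'] at hle
    simp only [Function.comp_apply] at hle
    rw [e₁, e₂] at hle
    linarith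
  · obtain ⟨m, n⟩ := p
    simp only [Function.comp_apply, Equiv.prodComm_apply, Prod.swap_prod_mk]
    rcases le_total n m with h | h
    · nlinarith [mul_nonneg (sub_nonneg.2 (hAB m n h)) (sub_nonneg.2 (hpow m n h))]
    · nlinarith [mul_nonneg (sub_nonneg.2 (hAB n m h)) (sub_nonneg.2 (hpow n m h))]

/-- Abelian theorem for the quotient of two power series, the second of which diverges at `1`. -/
lemma tendsto_tsum_div_tsum {r B : ℕ → ℝ} {L : ℝ} (hr : Monotone r)
    (hr0 : ∀ n, 0 ≤ r n) (hL : Tendsto r atTop (nhds L)) (hB : ∀ n, 0 ≤ B n)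
    (hBs : ∀ t, 0 ≤ t → t < 1 → Summable fun n => B n * t ^ n)
    (hBt : Tendsto (fun t => ∑' n, B n * t ^ n) (nhdsWithin 1 (Iio 1)) atTop) :
    Tendsto (fun t => (∑' n, r n * B n * t ^ n) / ∑' n, B n * t ^ n)
      (nhdsWithin 1 (Iio 1)) (nhds L) := by
  have hrL : ∀ n, r n ≤ L := hr.ge_of_tendsto hL
  have hAs : ∀ t, 0 ≤ t → t < 1 → Summable fun n => r n * B n * t ^ n := fun t h0 h1 =>
    Summable.of_nonneg_of_le (fun n => by have := hr0 n; have := hB n; positivity)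
      (fun n => by
        have := mul_nonneg (hB n) (pow_nonneg h0 n)
        have := mul_le_mul_of_nonneg_right (hrL n) this
        linarith) ((hBs t h0 h1).mul_left L)
  have hev : ∀ᶠ t in nhdsWithin (1 : ℝ) (Iio 1), 0 < t ∧ t < 1 :=
    (Filter.Eventually.filter_mono nhdsWithin_le_nhds (lt_mem_nhds one_pos)).and
      eventually_mem_nhdsWithin
  have hpos := hBt.eventually_gt_atTop 0
  refine tendsto_order.2 ⟨fun l hl => ?_, fun u hu => ?_⟩
  · obtain ⟨N, hN⟩ := (hL.eventually_const_lt hl).exists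
    have hK : Tendsto (fun t => r N - (r N * ∑ n ∈ Finset.range N, B n) / ∑' n, B n * t ^ n)
        (nhdsWithin 1 (Iio 1)) (nhds (r N)) := by
      simpa using tendsto_const_nhds.sub (tendsto_const_nhds.div_atTop hBt)
    filter_upwards [hK.eventually_const_lt hN, hev, hpos] with t h ⟨h0, h1⟩ hp
    refine h.trans_le ?_
    rw [← sub_nonneg]
    have hs := (hBs t h0.le h1).mul_left (r N)
    have hA := hAs t h0.le h1
    have hbound : r N * ∑' n, B n * t ^ n - r N * ∑ n ∈ Finset.range N, B n
        ≤ ∑' n, r n * B n * t ^ n := by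
      have hsub := (hs.sub hA).sum_add_tsum_nat_add N
      rw [hs.tsum_sub hA, tsum_mul_left] at hsub
      have ht : ∑' n, (r N * (B (n + N) * t ^ (n + N)) - r (n + N) * B (n + N) * t ^ (n + N)) ≤ 0 :=
        tsum_nonpos fun n => by
          have h2 := mul_nonneg (hB (n + N)) (pow_nonneg h0.le (n + N))
          have := mul_le_mul_of_nonneg_right (hr (Nat.le_add_left N n)) h2
          linarith
      have hf : ∑ n ∈ Finset.range N, (r N * (B n * t ^ n) - r n * B n * t ^ n)
          ≤ r N * ∑ n ∈ Finset.range N, B n := by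
        rw [Finset.mul_sum]
        refine Finset.sum_le_sum fun n _ => ?_
        have h3 : 0 ≤ r n * (B n * t ^ n) :=
          mul_nonneg (hr0 n) (mul_nonneg (hB n) (pow_nonneg h0.le n))
        have h4 : r N * (B n * t ^ n) ≤ r N * B n := mul_le_mul_of_nonneg_left
          (mul_le_of_le_one_right (hB n) (pow_le_one₀ h0.le h1.le)) (hr0 N)
        linarith
      linarith
    have := div_le_div_of_nonneg_right hbound hp.le
    rw [sub_div, mul_div_assoc, div_self hp.ne', mul_one] at this
    linarith
  · filter_upwards [hev, hpos] with t ⟨h0, h1⟩ hp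
    refine lt_of_le_of_lt ?_ hu
    rw [div_le_iff₀ hp, ← tsum_mul_left]
    refine (hAs t h0.le h1).tsum_le_tsum (fun n => ?_) ((hBs t h0.le h1).mul_left L)
    have := mul_nonneg (hB n) (pow_nonneg h0.le n)
    have := mul_le_mul_of_nonneg_right (hrL n) this
    linarith

lemma tendsto_shiftedFact_quotient {p q r s : ℝ} (hp : 0 < p) (hq : 0 < q) (hr : 0 < r)
    (hs : 0 < s) (h : p + q = r + s) :
    Tendsto (fun n => shiftedFact p n * shiftedFact q n / (shiftedFact r n * shiftedFact s n))
      atTop (nhds (Real.Gamma r * Real.Gamma s / (Real.Gamma p * Real.Gamma q))) := by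
  rw [← tendsto_add_atTop_iff_nat 1]
  have hG := ((Real.GammaSeq_tendsto_Gamma r).mul (Real.GammaSeq_tendsto_Gamma s)).div
    ((Real.GammaSeq_tendsto_Gamma p).mul (Real.GammaSeq_tendsto_Gamma q))
    (mul_pos (Real.Gamma_pos_of_pos hp) (Real.Gamma_pos_of_pos hq)).ne'
  refine hG.congr' ?_
  filter_upwards [eventually_gt_atTop 0] with n hn
  have hn' : (0 : ℝ) < n := by exact_mod_cast hn
  have e : (n : ℝ) ^ p * (n : ℝ) ^ q = (n : ℝ) ^ r * (n : ℝ) ^ s := by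
    rw [← Real.rpow_add hn', ← Real.rpow_add hn', h]
  have hp' := shiftedFact_pos hp (n + 1)
  have hq' := shiftedFact_pos hq (n + 1)
  have hr' := shiftedFact_pos hr (n + 1)
  have hs' := shiftedFact_pos hs (n + 1)
  have h1 := Real.rpow_pos_of_pos hn' p
  have h2 := Real.rpow_pos_of_pos hn' q
  simp only [Pi.div_apply, Real.GammaSeq]
  change _ * _ / shiftedFact r (n + 1) * (_ / shiftedFact s (n + 1)) /
    (_ / shiftedFact p (n + 1) * (_ / shiftedFact q (n + 1))) = _
  field_simp
  linear_combination -e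

lemma monotone_shiftedFact_quotient {p q r s : ℝ} (hp : 0 < p) (hq : 0 < q) (hr : 0 < r)
    (hs : 0 < s) (h : p + q = r + s) (h' : r * s ≤ p * q) :
    Monotone fun n =>
      shiftedFact p n * shiftedFact q n / (shiftedFact r n * shiftedFact s n) := by
  refine monotone_nat_of_le_succ fun n => ?_
  have hp' := shiftedFact_pos hp n
  have hq' := shiftedFact_pos hq n
  have hr' := shiftedFact_pos hr n
  have hs' := shiftedFact_pos hs n
  simp only [shiftedFact_succ]
  have key : (r + n) * (s + n) ≤ (p + n) * (q + n) := by nlinarith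
  have e : shiftedFact p n * (p + n) * (shiftedFact q n * (q + n)) /
      (shiftedFact r n * (r + n) * (shiftedFact s n * (s + n))) =
      shiftedFact p n * shiftedFact q n / (shiftedFact r n * shiftedFact s n) *
        (((p + n) * (q + n)) / ((r + n) * (s + n))) := by
    field_simp
  rw [e]
  exact le_mul_of_one_le_right (by positivity) ((one_le_div (by positivity)).2 key)

theorem stmt4 (a b c d : ℝ) (ha : 0 < a) (hb : 0 < b) (hc : 0 < c) (hd : 0 < d)
    (h1 : c < a + b) (h2 : max a b < c)
    (f g : ℝ → ℝ)
    (hf : ∀ x, f x = hypF a b c (1 - (1 + x) ^ (-1 / d)))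
    (hg : ∀ x, g x = (1 + x) ^ ((c + d - (a + b)) / d) * deriv f x) :
    MonotoneOn g (Set.Ici 0) ∧ g 0 = a * b / (c * d) ∧
    Tendsto g atTop
      (nhds ((a + b - c) * Real.Gamma c * Real.Gamma (a + b - c) /
        (d * Real.Gamma a * Real.Gamma b))) := by
  obtain ⟨hac, hbc⟩ := max_lt_iff.1 h2
  set s : ℝ := a + b + 1 - c with hs
  have hs0 : 0 < s := by linarith
  let τ : ℝ → ℝ := fun x => 1 - (1 + x) ^ (-1 / d)
  let B : ℕ → ℝ := fun n => shiftedFact s n / n.factorial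
  let r : ℕ → ℝ := fun n => shiftedFact (a + 1) n * shiftedFact (b + 1) n /
    (shiftedFact (c + 1) n * shiftedFact s n)
  let Φ : ℝ → ℝ := fun t => (∑' n, r n * B n * t ^ n) / ∑' n, B n * t ^ n
  have hBpos : ∀ n, 0 < B n := fun n => by have := shiftedFact_pos hs0 n; positivity
  have hrpos : ∀ n, 0 < r n := fun n => by
    have := shiftedFact_pos hs0 n
    have := shiftedFact_pos (show 0 < a + 1 by linarith) n
    have := shiftedFact_pos (show 0 < b + 1 by linarith) n
    have := shiftedFact_pos (show 0 < c + 1 by linarith) n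
    positivity
  have hrB : ∀ n, r n * B n = hypCoeff (a + 1) (b + 1) (c + 1) n := fun n => by
    have := shiftedFact_pos hs0 n
    have := shiftedFact_pos (show 0 < c + 1 by linarith) n
    simp only [r, B, hypCoeff]
    field_simp
  have hrmono : Monotone r := monotone_shiftedFact_quotient (by linarith) (by linarith)
    (by linarith) hs0 (by rw [hs]; ring)
    (by nlinarith [mul_pos (sub_pos.2 hac) (sub_pos.2 hbc)])
  have hrlim := tendsto_shiftedFact_quotient (p := a + 1) (q := b + 1) (r := c + 1) (s := s)
    (by linarith) (by linarith) (by linarith) hs0 (by rw [hs]; ring)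
  have hBsum : ∀ t, |t| < 1 → HasSum (fun n => B n * t ^ n) (1 / (1 - t) ^ s) :=
    fun t ht => hasSum_one_div_one_sub_rpow s ht
  have hAsum : ∀ t, |t| < 1 → Summable fun n => r n * B n * t ^ n := fun t ht => by
    simp only [hrB]
    exact hypCoeff_summable (by linarith) (by linarith) (by linarith) ht
  have hτ : ∀ x, 0 ≤ x → 0 ≤ τ x ∧ τ x < 1 := fun x hx => by
    have h3 : (1 + x) ^ (-1 / d) ≤ 1 := Real.rpow_le_one_of_one_le_of_nonpos (by linarith)
      (div_nonpos_of_nonpos_of_nonneg (by norm_num) hd.le)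
    have h4 : 0 < (1 + x) ^ (-1 / d) := Real.rpow_pos_of_pos (by linarith) _
    exact ⟨by simp only [τ]; linarith, by simp only [τ]; linarith⟩
  have habs : ∀ x, 0 ≤ x → |τ x| < 1 := fun x hx => by
    rw [abs_of_nonneg (hτ x hx).1]; exact (hτ x hx).2
  have hgΦ : ∀ x, 0 ≤ x → g x = a * b / (c * d) * Φ (τ x) := by
    intro x hx
    have hx1 : 0 < 1 + x := by linarith
    have hτd : HasDerivAt τ (1 / d * (1 + x) ^ (-1 / d - 1)) x := by
      have := ((((hasDerivAt_id x).const_add 1).rpow_const (p := -1 / d)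
        (Or.inl hx1.ne'))).const_sub 1
      refine this.congr_deriv ?_
      simp only [id]
      ring
    have hfd : deriv f x = a * b / c * hypF (a + 1) (b + 1) (c + 1) (τ x) *
        (1 / d * (1 + x) ^ (-1 / d - 1)) := by
      rw [show f = hypF a b c ∘ τ from funext hf]
      exact ((hypF_hasDerivAt ha hb hc (habs x hx)).comp x hτd).deriv
    have hF : hypF (a + 1) (b + 1) (c + 1) (τ x) = ∑' n, r n * B n * τ x ^ n := by
      simp only [hrB]; rfl
    have hpow : (1 + x) ^ ((c + d - (a + b)) / d) * (1 + x) ^ (-1 / d - 1) = (1 - τ x) ^ s := by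
      have : 1 - τ x = (1 + x) ^ (-1 / d) := by simp [τ]
      rw [this, ← Real.rpow_add hx1, ← Real.rpow_mul hx1.le]
      congr 1
      rw [hs]
      field_simp
      ring
    simp only [hg, hfd, Φ]
    rw [← hF, (hBsum _ (habs x hx)).tsum_eq, div_div_eq_mul_div, div_one, ← hpow]
    field_simp
  refine ⟨?_, ?_, ?_⟩
  · intro x hx y hy hxy
    rw [hgΦ x hx, hgΦ y hy]
    refine mul_le_mul_of_nonneg_left ?_ (by positivity)
    have hxy' : τ x ≤ τ y := by
      have : (1 + y) ^ (-1 / d) ≤ (1 + x) ^ (-1 / d) := Real.rpow_le_rpow_of_nonpos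
        (by have := mem_Ici.1 hx; linarith) (by linarith)
        (div_nonpos_of_nonpos_of_nonneg (by norm_num) hd.le)
      simp only [τ]; linarith
    have hpos : ∀ x, 0 ≤ x → 0 < ∑' n, B n * τ x ^ n := fun x hx => by
      rw [(hBsum _ (habs x hx)).tsum_eq]
      exact one_div_pos.2 (Real.rpow_pos_of_pos (sub_pos.2 (hτ x hx).2) _)
    simp only [Φ]
    rw [div_le_div_iff₀ (hpos x hx) (hpos y hy)]
    refine tsum_mul_tsum_le_of_coeff (fun m n hmn => ?_) (hτ x hx).1 hxy'
      (fun n => (mul_pos (hrpos n) (hBpos n)).le) (fun n => (hBpos n).le)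
      (hAsum _ (habs x hx)) (hAsum _ (habs y hy)) (hBsum _ (habs x hx)).summable
      (hBsum _ (habs y hy)).summable
    have := mul_le_mul_of_nonneg_right (hrmono hmn) (mul_pos (hBpos n) (hBpos m)).le
    linarith
  · have h0 : ∀ C : ℕ → ℝ, ∑' n, C n * (0 : ℝ) ^ n = C 0 := fun C => by
      rw [tsum_eq_single 0 fun n hn => by simp [hn]]; simp
    rw [hgΦ 0 le_rfl, show τ 0 = 0 by simp [τ]]
    simp only [Φ]
    rw [h0, h0]
    simp [r, B, shiftedFact]
  · have hBt : Tendsto (fun t => ∑' n, B n * t ^ n) (nhdsWithin 1 (Iio 1)) atTop := by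
      have h5 : Tendsto (fun t : ℝ => 1 - t) (nhdsWithin 1 (Iio 1)) (nhdsWithin 0 (Ioi 0)) := by
        refine tendsto_nhdsWithin_iff.2 ⟨?_, ?_⟩
        · have : Tendsto (fun t : ℝ => 1 - t) (nhds 1) (nhds (1 - 1)) :=
            tendsto_const_nhds.sub tendsto_id
          rw [sub_self] at this
          exact this.mono_left nhdsWithin_le_nhds
        · filter_upwards [eventually_mem_nhdsWithin] with t ht
          exact sub_pos.2 (mem_Iio.1 ht)
      have h6 := (tendsto_rpow_neg_nhdsGT_zero (neg_lt_zero.2 hs0)).comp h5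
      refine h6.congr' ?_
      filter_upwards [eventually_mem_nhdsWithin,
        Filter.Eventually.filter_mono nhdsWithin_le_nhds (lt_mem_nhds one_pos)] with t ht ht0
      have ht1 : t < 1 := ht
      rw [(hBsum t (by rw [abs_of_pos ht0]; exact ht1)).tsum_eq, Function.comp_apply,
        Real.rpow_neg (by linarith), one_div]
    have hΦ := tendsto_tsum_div_tsum hrmono (fun n => (hrpos n).le) hrlim (fun n => (hBpos n).le)
      (fun t h0 h1 => (hBsum t (by rwa [abs_of_nonneg h0])).summable) hBt
    have hτt : Tendsto τ atTop (nhdsWithin 1 (Iio 1)) := by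
      refine tendsto_nhdsWithin_iff.2 ⟨?_, ?_⟩
      · have h7 := (tendsto_rpow_neg_atTop (one_div_pos.2 hd)).comp
          (tendsto_atTop_add_const_left atTop (1 : ℝ) tendsto_id)
        have h8 := (tendsto_const_nhds (x := (1 : ℝ))).sub h7
        rw [sub_zero] at h8
        refine h8.congr fun x => ?_
        simp [τ, neg_div]
      · filter_upwards [eventually_ge_atTop 0] with x hx
        exact (hτ x hx).2
    have hlim := (hΦ.comp hτt).const_mul (a * b / (c * d))
    have hval : a * b / (c * d) * (Real.Gamma (c + 1) * Real.Gamma s /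
        (Real.Gamma (a + 1) * Real.Gamma (b + 1))) =
        (a + b - c) * Real.Gamma c * Real.Gamma (a + b - c) /
        (d * Real.Gamma a * Real.Gamma b) := by
      have := Real.Gamma_pos_of_pos ha
      have := Real.Gamma_pos_of_pos hb
      rw [show s = a + b - c + 1 by rw [hs]; ring, Real.Gamma_add_one hc.ne',
        Real.Gamma_add_one ha.ne', Real.Gamma_add_one hb.ne',
        Real.Gamma_add_one (by linarith : 0 < a + b - c).ne']
      field_simp
    rw [hval] at hlim
    refine hlim.congr' ?_
    filter_upwards [eventually_ge_atTop 0] with x hx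
    exact (hgΦ x hx).symm
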